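/- Let v : [−1,1] → ℝ be four times continuously differentiable. Then the series Σ_{n=1}^∞ n(n+1)|v_n| converges, where v_n is the n-th Fourier–Legendre coefficient of v. -/

import Mathlib

open MeasureTheory

/-- The `n`-th Legendre polynomial via Rodrigues' formula
`P_n(x) = (1/(2^n n!)) dⁿ/dxⁿ (x²−1)ⁿ`. -/
noncomputable def legendreP (n : ℕ) (x : ℝ) : ℝ :=
  (1 / (2 ^ n * (Nat.factorial n : ℝ))) * iteratedDeriv n (fun y : ℝ => (y ^ 2 - 1) ^ n) x

/-- The `n`-th Fourier–Legendre coefficient `f_n = ((2n+1)/2) ∫_{−1}^1 f(x) P_n(x) dx`. -/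
noncomputable def flCoeff (f : ℝ → ℝ) (n : ℕ) : ℝ :=
  ((2 * (n : ℝ) + 1) / 2) * ∫ x in (-1 : ℝ)..1, f x * legendreP n x

/-- The L² norm of a function on `(−1,1)`: `‖g‖ = (∫_{−1}^1 g(x)² dx)^{1/2}`. -/
noncomputable def L2norm (g : ℝ → ℝ) : ℝ :=
  Real.sqrt (∫ x in (-1 : ℝ)..1, g x ^ 2)

open Polynomial intervalIntegral

/-- The unnormalised Legendre polynomial `dⁿ/dxⁿ (x² - 1)ⁿ`. -/
noncomputable def rodrigues (n : ℕ) : ℝ[X] :=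
  derivative^[n] ((X ^ 2 - 1) ^ n)

theorem iteratedDeriv_eval (p : ℝ[X]) (n : ℕ) :
    iteratedDeriv n (fun x => p.eval x) = fun x => (derivative^[n] p).eval x := by
  induction n with
  | zero => simp
  | succ k ih =>
    rw [iteratedDeriv_succ, ih, Function.iterate_succ_apply']
    ext x
    exact Polynomial.deriv _

theorem legendreP_eq (n : ℕ) (x : ℝ) :
    legendreP n x = 1 / (2 ^ n * (n.factorial : ℝ)) * (rodrigues n).eval x := by
  have h : (fun y : ℝ => (y ^ 2 - 1) ^ n) = fun y => ((X ^ 2 - 1 : ℝ[X]) ^ n).eval y := by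
    ext y; simp
  rw [legendreP, h, iteratedDeriv_eval, rodrigues]

theorem iterate_derivative_X_sq_sub_one_mul (z : ℝ[X]) (k : ℕ) :
    derivative^[k + 1] ((X ^ 2 - 1) * derivative z) =
      (X ^ 2 - 1) * derivative^[k + 2] z + 2 * ((k : ℝ[X]) + 1) * X * derivative^[k + 1] z
        + ((k : ℝ[X]) + 1) * (k : ℝ[X]) * derivative^[k] z := by
  induction k with
  | zero => simp; ring
  | succ k ih =>
    rw [Function.iterate_succ_apply', ih]
    simp only [derivative_add, derivative_mul, derivative_sub, derivative_X_pow, derivative_one,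
      derivative_X, derivative_natCast, derivative_ofNat, ← Function.iterate_succ_apply']
    push_cast
    simp [show (C 2 : ℝ[X]) = 2 from rfl]
    ring

theorem derivative_X_sq_sub_one_mul_derivative_rodrigues (n : ℕ) :
    derivative ((X ^ 2 - 1) * derivative (rodrigues n)) =
      (n : ℝ[X]) * ((n : ℝ[X]) + 1) * rodrigues n := by
  have hu : (X ^ 2 - 1) * derivative ((X ^ 2 - 1 : ℝ[X]) ^ n) =
      ((2 * n : ℕ) : ℝ[X]) * ((X ^ 2 - 1) ^ n * X) := by
    cases n with
    | zero => simp
    | succ m => rw [derivative_pow]; simp; ring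
  have h := congrArg derivative^[n + 1] hu
  rw [iterate_derivative_X_sq_sub_one_mul, iterate_derivative_natCast_mul,
    iterate_derivative_mul_X] at h
  simp only [Function.iterate_succ_apply', Nat.add_sub_cancel, nsmul_eq_mul] at h
  rw [← rodrigues] at h
  push_cast at h
  simp only [derivative_mul, derivative_sub, derivative_X_pow, derivative_one]
  simp [show (C 2 : ℝ[X]) = 2 from rfl]
  linear_combination h

theorem eval_iterate_derivative_X_sq_sub_one_pow {k n : ℕ} (hk : k < n) {a : ℝ} (ha : a ^ 2 = 1) :
    (derivative^[k] ((X ^ 2 - 1 : ℝ[X]) ^ n)).eval a = 0 := by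
  obtain ⟨q, hq⟩ := (dvd_pow_self (X ^ 2 - 1 : ℝ[X]) (Nat.sub_ne_zero_of_lt hk)).trans
    (pow_sub_dvd_iterate_derivative_pow (X ^ 2 - 1 : ℝ[X]) n k)
  simp [hq, ha]

theorem integral_mul_eval_derivative {f : ℝ → ℝ} (hf : ContDiffOn ℝ 1 f (Set.Icc (-1) 1))
    (p : ℝ[X]) :
    ∫ x in (-1 : ℝ)..1, f x * (derivative p).eval x =
      f 1 * p.eval 1 - f (-1) * p.eval (-1) -
        ∫ x in (-1 : ℝ)..1, derivWithin f (Set.Icc (-1) 1) x * p.eval x := by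
  have hI : Set.uIcc (-1 : ℝ) 1 = Set.Icc (-1) 1 := Set.uIcc_of_le (by norm_num)
  refine integral_mul_deriv_eq_deriv_mul_of_hasDerivWithinAt (fun x hx => ?_)
    (fun x _ => (p.hasDerivAt x).hasDerivWithinAt) ?_
    (derivative p).continuous.continuousOn.intervalIntegrable
  · rw [hI] at hx ⊢
    exact (hf.differentiableOn one_ne_zero x hx).hasDerivWithinAt
  · refine ContinuousOn.intervalIntegrable ?_
    rw [hI]
    exact hf.continuousOn_derivWithin (uniqueDiffOn_Icc (by norm_num)) le_rfl

theorem integral_eval_mul_eval_derivative (q p : ℝ[X]) :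
    ∫ x in (-1 : ℝ)..1, q.eval x * (derivative p).eval x =
      q.eval 1 * p.eval 1 - q.eval (-1) * p.eval (-1) -
        ∫ x in (-1 : ℝ)..1, (derivative q).eval x * p.eval x :=
  integral_mul_deriv_eq_deriv_mul (fun x _ => q.hasDerivAt x) (fun x _ => p.hasDerivAt x)
    (derivative q).continuous.continuousOn.intervalIntegrable
    (derivative p).continuous.continuousOn.intervalIntegrable

theorem integral_eval_mul_iterate_derivative (n k : ℕ) (hk : k ≤ n) (q : ℝ[X]) :
    ∫ x in (-1 : ℝ)..1, q.eval x * (derivative^[k] ((X ^ 2 - 1 : ℝ[X]) ^ n)).eval x =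
      (-1) ^ k * ∫ x in (-1 : ℝ)..1, (derivative^[k] q).eval x * (x ^ 2 - 1) ^ n := by
  induction k generalizing q with
  | zero => simp
  | succ k ih =>
    rw [Function.iterate_succ_apply', integral_eval_mul_eval_derivative, ih (by omega),
      eval_iterate_derivative_X_sq_sub_one_pow hk (by norm_num),
      eval_iterate_derivative_X_sq_sub_one_pow hk (by norm_num), Function.iterate_succ_apply]
    ring

theorem integral_one_sub_sq_pow_succ (n : ℕ) :
    (2 * (n : ℝ) + 3) * ∫ x in (-1 : ℝ)..1, (1 - x ^ 2) ^ (n + 1) =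
      2 * ((n : ℝ) + 1) * ∫ x in (-1 : ℝ)..1, (1 - x ^ 2) ^ n := by
  have h : ∫ x in (-1 : ℝ)..1, ((2 * (n : ℝ) + 3) * (1 - x ^ 2) ^ (n + 1) -
      2 * ((n : ℝ) + 1) * (1 - x ^ 2) ^ n) = 0 := by
    rw [integral_eq_sub_of_hasDerivAt (f := fun x : ℝ => x * (1 - x ^ 2) ^ (n + 1))]
    · simp
    · intro x _
      have := (hasDerivAt_id' x).mul ((((hasDerivAt_id' x).pow 2).const_sub 1).pow (n + 1))
      refine this.congr_deriv ?_
      simp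
      ring
    · exact Continuous.intervalIntegrable (by fun_prop) _ _
  rw [integral_sub (Continuous.intervalIntegrable (by fun_prop) _ _)
    (Continuous.intervalIntegrable (by fun_prop) _ _), intervalIntegral.integral_const_mul, intervalIntegral.integral_const_mul] at h
  linarith

theorem integral_one_sub_sq_pow (n : ℕ) :
    ((2 * n + 1).factorial : ℝ) * ∫ x in (-1 : ℝ)..1, (1 - x ^ 2) ^ n =
      2 * (2 ^ n * (n.factorial : ℝ)) ^ 2 := by
  induction n with
  | zero => simp; norm_num
  | succ n ih =>
    have h := integral_one_sub_sq_pow_succ n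
    rw [show 2 * (n + 1) + 1 = 2 * n + 1 + 1 + 1 by ring, Nat.factorial_succ, Nat.factorial_succ,
      Nat.factorial_succ n]
    push_cast
    linear_combination (2 * (n : ℝ) + 2) * ((2 * n + 1).factorial : ℝ) * h +
      (2 * (n : ℝ) + 2) ^ 2 * ih

theorem iterate_derivative_X_sq_sub_one_pow (n : ℕ) :
    derivative^[2 * n] ((X ^ 2 - 1 : ℝ[X]) ^ n) = C ((2 * n).factorial : ℝ) := by
  have hm : (X ^ 2 - 1 : ℝ[X]).Monic := by
    simpa using monic_X_pow_sub_C (1 : ℝ) two_ne_zero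
  have hd : ((X ^ 2 - 1 : ℝ[X]) ^ n).natDegree = 2 * n := by
    have : (X ^ 2 - 1 : ℝ[X]).natDegree = 2 := by
      simpa using natDegree_X_pow_sub_C (n := 2) (r := (1 : ℝ))
    rw [hm.natDegree_pow, this, mul_comm]
  have h0 : (derivative^[2 * n] ((X ^ 2 - 1 : ℝ[X]) ^ n)).natDegree ≤ 0 := by
    have := natDegree_iterate_derivative ((X ^ 2 - 1 : ℝ[X]) ^ n) (2 * n)
    rwa [hd, Nat.sub_self] at this
  have hc : ((X ^ 2 - 1 : ℝ[X]) ^ n).coeff (2 * n) = 1 := by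
    rw [← hd]; exact hm.pow n
  rw [eq_C_of_natDegree_le_zero h0, coeff_iterate_derivative]
  simp [hc, Nat.descFactorial_self]

theorem integral_legendreP_sq (n : ℕ) :
    ∫ x in (-1 : ℝ)..1, legendreP n x ^ 2 = 2 / (2 * n + 1) := by
  have h1 : ∫ x in (-1 : ℝ)..1, (rodrigues n).eval x * (rodrigues n).eval x =
      (2 * n).factorial * ∫ x in (-1 : ℝ)..1, (1 - x ^ 2) ^ n := by
    conv_lhs => enter [1, x]; rw [rodrigues]
    rw [integral_eval_mul_iterate_derivative n n le_rfl, ← Function.iterate_add_apply, ← two_mul,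
      iterate_derivative_X_sq_sub_one_pow, ← intervalIntegral.integral_const_mul, ← intervalIntegral.integral_const_mul]
    congr 1 with x
    rw [eval_C, show 1 - x ^ 2 = -1 * (x ^ 2 - 1) by ring, mul_pow]
    ring
  have h2 := integral_one_sub_sq_pow n
  rw [Nat.factorial_succ] at h2
  push_cast at h2
  have h3 : ∀ x, legendreP n x ^ 2 = (1 / (2 ^ n * (n.factorial : ℝ))) ^ 2 *
      ((rodrigues n).eval x * (rodrigues n).eval x) := fun x => by rw [legendreP_eq]; ring
  simp_rw [h3]
  rw [intervalIntegral.integral_const_mul, h1]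
  have : (n.factorial : ℝ) ≠ 0 := by positivity
  have : (2 * (n : ℝ) + 1) ≠ 0 := by positivity
  field_simp
  linear_combination h2

theorem continuous_legendreP (n : ℕ) : Continuous (legendreP n) := by
  simp_rw [funext (legendreP_eq n)]
  fun_prop

theorem integral_abs_legendreP_le (n : ℕ) :
    ∫ x in (-1 : ℝ)..1, |legendreP n x| ≤ 2 / √(2 * n + 1) := by
  set s : ℝ := √(2 * n + 1)
  have hs0 : 0 < s := by positivity
  have hs2 : s ^ 2 = 2 * n + 1 := Real.sq_sqrt (by positivity)
  have hc := continuous_legendreP n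
  have hle : ∫ x in (-1 : ℝ)..1, |legendreP n x| ≤
      ∫ x in (-1 : ℝ)..1, (1 / (2 * s) + s / 2 * legendreP n x ^ 2) := by
    refine integral_mono_on (by norm_num) (Continuous.intervalIntegrable (by fun_prop) _ _)
      (Continuous.intervalIntegrable (by fun_prop) _ _) fun x _ => ?_
    rw [← sq_abs (legendreP n x)]
    have : 1 / (2 * s) + s / 2 * |legendreP n x| ^ 2 - |legendreP n x| =
        (s * |legendreP n x| - 1) ^ 2 / (2 * s) := by
      field_simp; ring
    have : 0 ≤ (s * |legendreP n x| - 1) ^ 2 / (2 * s) := by positivity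
    linarith
  refine hle.trans_eq ?_
  rw [integral_add (by simp) (Continuous.intervalIntegrable (by fun_prop) _ _),
    intervalIntegral.integral_const_mul, integral_legendreP_sq, ← hs2]
  simp
  field_simp
  norm_num

/-- The Legendre differential operator `f ↦ ((x² - 1) f')'` on `[-1, 1]`. -/
noncomputable def legendreOp (f : ℝ → ℝ) : ℝ → ℝ :=
  derivWithin (fun x => (x ^ 2 - 1) * derivWithin f (Set.Icc (-1) 1) x) (Set.Icc (-1) 1)

theorem contDiffOn_sq_sub_one_mul_derivWithin {f : ℝ → ℝ} {m : ℕ}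
    (hf : ContDiffOn ℝ (m + 1) f (Set.Icc (-1) 1)) :
    ContDiffOn ℝ m (fun x => (x ^ 2 - 1) * derivWithin f (Set.Icc (-1) 1) x) (Set.Icc (-1) 1) :=
  ContDiffOn.mul (by fun_prop) (hf.derivWithin (uniqueDiffOn_Icc (by norm_num)) le_rfl)

theorem contDiffOn_legendreOp {f : ℝ → ℝ} {m : ℕ}
    (hf : ContDiffOn ℝ ((m + 1 : ℕ) + 1) f (Set.Icc (-1) 1)) :
    ContDiffOn ℝ m (legendreOp f) (Set.Icc (-1) 1) :=
  (contDiffOn_sq_sub_one_mul_derivWithin hf).derivWithin (uniqueDiffOn_Icc (by norm_num))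
    (by norm_cast)

theorem integral_legendreOp_mul_eval {f : ℝ → ℝ} (hf : ContDiffOn ℝ 2 f (Set.Icc (-1) 1))
    (p : ℝ[X]) :
    ∫ x in (-1 : ℝ)..1, legendreOp f x * p.eval x =
      ∫ x in (-1 : ℝ)..1, f x * (derivative ((X ^ 2 - 1) * derivative p)).eval x := by
  have h1 := integral_mul_eval_derivative (hf.of_le (by norm_num)) ((X ^ 2 - 1) * derivative p)
  have h2 := integral_mul_eval_derivative
    (contDiffOn_sq_sub_one_mul_derivWithin (m := 1) (hf.of_le (by norm_num))) p
  rw [← legendreOp] at h2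
  simp only [eval_mul, eval_sub, eval_pow, eval_X, eval_one] at h1
  have h3 : ∀ x, derivWithin f (Set.Icc (-1) 1) x * ((x ^ 2 - 1) * (derivative p).eval x) =
      (x ^ 2 - 1) * derivWithin f (Set.Icc (-1) 1) x * (derivative p).eval x := fun x => by ring
  simp_rw [h3] at h1
  rw [h1, h2]
  ring

theorem flCoeff_legendreOp {f : ℝ → ℝ} (hf : ContDiffOn ℝ 2 f (Set.Icc (-1) 1)) (n : ℕ) :
    flCoeff (legendreOp f) n = n * (n + 1) * flCoeff f n := by
  have hP : ∀ g : ℝ → ℝ, flCoeff g n = (2 * (n : ℝ) + 1) / 2 * (1 / (2 ^ n * (n.factorial : ℝ)) *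
      ∫ x in (-1 : ℝ)..1, g x * (rodrigues n).eval x) := fun g => by
    rw [flCoeff, ← intervalIntegral.integral_const_mul (1 / _)]
    congr 2 with x
    rw [legendreP_eq, mul_left_comm]
  have h : ∀ x, f x * ((n : ℝ) * (n + 1) * (rodrigues n).eval x) =
      n * (n + 1) * (f x * (rodrigues n).eval x) := fun x => by ring
  rw [hP, hP, integral_legendreOp_mul_eval hf, derivative_X_sq_sub_one_mul_derivative_rodrigues]
  simp only [eval_mul, eval_add, eval_natCast, eval_one, h, intervalIntegral.integral_const_mul]
  ring

theorem abs_flCoeff_le {f : ℝ → ℝ} {M : ℝ} (hM : ∀ x ∈ Set.Icc (-1 : ℝ) 1, |f x| ≤ M) (n : ℕ) :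
    |flCoeff f n| ≤ M * √(2 * n + 1) := by
  have hM0 : 0 ≤ M := (abs_nonneg _).trans (hM 0 (by norm_num))
  have hc := continuous_legendreP n
  have h : |∫ x in (-1 : ℝ)..1, f x * legendreP n x| ≤ M * (2 / √(2 * n + 1)) := by
    calc |∫ x in (-1 : ℝ)..1, f x * legendreP n x|
        ≤ ∫ x in (-1 : ℝ)..1, M * |legendreP n x| := by
          rw [← Real.norm_eq_abs]
          refine norm_integral_le_of_norm_le (by norm_num : (-1 : ℝ) ≤ 1)
            (Filter.Eventually.of_forall ?_)
            ((hc.abs.const_mul M).intervalIntegrable _ _)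
          intro x hx
          rw [norm_mul, Real.norm_eq_abs, Real.norm_eq_abs]
          exact mul_le_mul_of_nonneg_right (hM x (Set.Ioc_subset_Icc_self hx)) (abs_nonneg _)
      _ ≤ M * (2 / √(2 * n + 1)) := by
          rw [intervalIntegral.integral_const_mul]
          exact mul_le_mul_of_nonneg_left (integral_abs_legendreP_le n) hM0
  have hs2 : √(2 * (n : ℝ) + 1) ^ 2 = 2 * n + 1 := Real.sq_sqrt (by positivity)
  have hs0 : 0 < √(2 * (n : ℝ) + 1) := by positivity
  rw [flCoeff, abs_mul, abs_of_nonneg (by positivity)]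
  refine (mul_le_mul_of_nonneg_left h (by positivity)).trans_eq ?_
  field_simp
  rw [hs2, mul_comm]

theorem summable_flCoeff (v : ℝ → ℝ)
    (hv : ContDiffOn ℝ 4 v (Set.Icc (-1) 1)) :
    Summable (fun n : ℕ => (n : ℝ) * ((n : ℝ) + 1) * |flCoeff v n|) := by
  have hv1 : ContDiffOn ℝ 2 (legendreOp v) (Set.Icc (-1) 1) :=
    contDiffOn_legendreOp (m := 2) (hv.of_le (by norm_num))
  have hv2 : ContinuousOn (legendreOp (legendreOp v)) (Set.Icc (-1) 1) :=
    (contDiffOn_legendreOp (m := 0) (hv1.of_le (by norm_num))).continuousOn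
  obtain ⟨M, hM⟩ := isCompact_Icc.exists_bound_of_continuousOn hv2
  have hM0 : 0 ≤ M := (norm_nonneg _).trans (hM 0 (by norm_num))
  have hs : Summable fun n : ℕ => 2 * M * (1 / (n : ℝ) ^ (3 / 2 : ℝ)) :=
    (Real.summable_one_div_nat_rpow.2 (by norm_num)).mul_left _
  refine Summable.of_nonneg_of_le (fun n => by positivity) (fun n => ?_) hs
  rcases n.eq_zero_or_pos with rfl | hn
  · simp
  have hn1 : (1 : ℝ) ≤ n := by exact_mod_cast hn
  have hn0 : (0 : ℝ) < n := by linarith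
  have h := abs_flCoeff_le hM n
  rw [flCoeff_legendreOp hv1, flCoeff_legendreOp (hv.of_le (by norm_num)),
    abs_mul ((n : ℝ) * (n + 1)), abs_mul ((n : ℝ) * (n + 1)),
    abs_of_nonneg (by positivity : (0 : ℝ) ≤ n * (n + 1))] at h
  have hsq : √(2 * (n : ℝ) + 1) ≤ 2 * √n := by
    rw [Real.sqrt_le_left (by positivity), mul_pow, Real.sq_sqrt hn0.le]
    linarith
  have hpow : (n : ℝ) ^ (3 / 2 : ℝ) = n * √n := by
    rw [Real.sqrt_eq_rpow, ← Real.rpow_one_add' hn0.le (by norm_num)]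
    norm_num
  have hr : √(n : ℝ) ^ 2 = n := Real.sq_sqrt hn0.le
  have hr0 : 0 < √(n : ℝ) := by positivity
  rw [hpow, mul_one_div, le_div_iff₀ (by positivity)]
  have h4 : n * n * (n * (n + 1) * |flCoeff v n|) ≤ 2 * M * √n := by
    calc n * n * (n * (n + 1) * |flCoeff v n|)
        ≤ n * (n + 1) * (n * (n + 1) * |flCoeff v n|) := by gcongr; linarith
      _ ≤ M * (2 * √n) := h.trans (by gcongr)
      _ = 2 * M * √n := by ring
  refine le_of_mul_le_mul_right ?_ hr0
  calc n * (n + 1) * |flCoeff v n| * (n * √n) * √n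
      = n * (√n ^ 2) * (n * (n + 1) * |flCoeff v n|) := by ring
    _ ≤ 2 * M * √n := by rwa [hr]
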